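/- arXiv:2310.16962 — 6 statements merged into one kernel-verified Lean document; each statement's English description precedes it below -/
import Mathlib

section
/- For every integer N > 0, set k_N = 1/2^(N+4). If a finite bipartite graph (X, Y; E) has VC-minimal complexity < N, then there exist subsets X' ⊆ X and Y' ⊆ Y with |X'| ≥ k_N·|X| and |Y'| ≥ k_N·|Y| such that X' × Y' ⊆ E or (X' × Y') ∩ E = ∅. -/
open Set

/-- A family of sets is *directed* if any two members are comparable or disjoint. -/
def DirectedFamily {α : Type*} (Ψ : Set (Set α)) : Prop :=
  ∀ B₁ ∈ Ψ, ∀ B₂ ∈ Ψ, B₁ ⊆ B₂ ∨ B₂ ⊆ B₁ ∨ B₁ ∩ B₂ = ∅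

/-- The Swiss cheese with outer ball `B` and list of holes `hs`. -/
def SwissCheese {α : Type*} (B : Set α) (hs : List (Set α)) : Set α :=
  B \ ⋃ K ∈ hs, K

/-- `L` is a decomposition of `S` into pairwise disjoint `Ψ`-Swiss cheeses:
each entry of `L` is a pair (outer ball, list of holes), all balls belonging to `Ψ`. -/
def IsSCDecomp {α : Type*} (Ψ : Set (Set α)) (S : Set α)
    (L : List (Set α × List (Set α))) : Prop :=
  (∀ p ∈ L, p.1 ∈ Ψ ∧ ∀ K ∈ p.2, K ∈ Ψ) ∧
  L.Pairwise (fun p q => SwissCheese p.1 p.2 ∩ SwissCheese q.1 q.2 = ∅) ∧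
  S = ⋃ p ∈ L, SwissCheese p.1 p.2

/-- The total number of outer balls plus holes in a decomposition. -/
def SCCount {α : Type*} (L : List (Set α × List (Set α))) : ℕ :=
  (L.map fun p => 1 + p.2.length).sum

/-- The set of balls (outer balls and holes) occurring in a decomposition. -/
def BallsOf {α : Type*} (L : List (Set α × List (Set α))) : Set (Set α) :=
  {B | ∃ p ∈ L, B = p.1 ∨ B ∈ p.2}

/-- A bipartite graph `(X, Y; E)` has VC-minimal complexity `< N` if there is a
directed family `Ψ` of subsets of `Y` such that for each `a ∈ X`, `E(a, Y)` is a
finite disjoint union of `Ψ`-Swiss cheeses with (number of outer balls) +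
(number of holes) `< N`. -/
def VCMinCompLT {α : Type*} (X Y : Set α) (E : Set (α × α)) (N : ℕ) : Prop :=
  ∃ Ψ : Set (Set α), (∀ B ∈ Ψ, B ⊆ Y) ∧ DirectedFamily Ψ ∧
    ∀ a ∈ X, ∃ L, IsSCDecomp Ψ {b ∈ Y | (a, b) ∈ E} L ∧ SCCount L < N

open Classical in
lemma exists_order {α : Type*} (Ψ : Set (Set α)) (hD : DirectedFamily Ψ) :
    ∀ (n : ℕ) (Y : Finset α), Y.card = n → ∃ f : α → ℕ, Set.InjOn f Y ∧ (∀ y ∈ Y, f y < Y.card) ∧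
      ∀ C ∈ Ψ, C ⊆ (Y : Set α) → ∀ x ∈ C, ∀ y ∈ Y, ∀ z ∈ C, f x ≤ f y → f y ≤ f z → y ∈ C := by
  intro n
  induction n using Nat.strong_induction_on with
  | _ n ih =>
  intro Y hn
  by_cases h : ∃ B : Finset α, (B : Set α) ∈ Ψ ∧ B.Nonempty ∧ B ⊂ Y
  · obtain ⟨B, hB, hmax⟩ : ∃ B ∈ Y.powerset.filter (fun B : Finset α => (B : Set α) ∈ Ψ ∧ B.Nonempty ∧ B ⊂ Y),
        ∀ C ∈ Y.powerset.filter (fun B : Finset α => (B : Set α) ∈ Ψ ∧ B.Nonempty ∧ B ⊂ Y),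
          C.card ≤ B.card := by
      apply Finset.exists_max_image
      obtain ⟨B, h1, h2, h3⟩ := h
      exact ⟨B, by simp [h1, h2, h3, h3.subset]⟩
    simp only [Finset.mem_filter, Finset.mem_powerset] at hB hmax
    obtain ⟨hBY, hBΨ, hBne, hBss⟩ := hB
    have hc := Finset.card_lt_card hBss
    have hsd := Finset.card_sdiff_add_card_eq_card hBY
    have hpos := hBne.card_pos
    obtain ⟨f, f1, f2, f3⟩ := ih B.card (by omega) B rfl
    obtain ⟨g, g1, g2, g3⟩ := ih (Y \ B).card (by omega) (Y \ B) rfl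
    refine ⟨fun y => if y ∈ B then f y else B.card + g y, ?_, ?_, ?_⟩
    · intro x hx y hy hxy
      simp only at hxy
      split_ifs at hxy with h1 h2 h2
      · exact f1 h1 h2 hxy
      · have := f2 x h1; omega
      · have := f2 y h2; omega
      · exact g1 (by simpa [h1] using hx) (by simpa [h2] using hy) (by omega)
    · intro y hy
      simp only
      split_ifs with h1
      · have := f2 y h1; omega
      · have := g2 y (by simp [h1, hy]); omega
    · intro C hC hCY x hx y hy z hz hxy hyz
      by_cases hCe : C = (Y : Set α)
      · rw [hCe]; exact hy
      have hCB : C ⊆ (B : Set α) ∨ C ∩ B = ∅ := by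
        rcases hD C hC B hBΨ with h1 | h1 | h1
        · exact Or.inl h1
        · left
          have hfin : C.Finite := Y.finite_toSet.subset hCY
          have hCc : ((hfin.toFinset : Finset α) : Set α) = C := hfin.coe_toFinset
          have hsub : hfin.toFinset ⊆ Y := by
            rw [← Finset.coe_subset, hCc]; exact hCY
          have hBC : B ⊆ hfin.toFinset := by
            rw [← Finset.coe_subset, hCc]; exact h1
          have := hmax hfin.toFinset ⟨hsub, by rw [hCc]; exact hC, hBne.mono hBC, by
            refine Finset.ssubset_iff_subset_ne.2 ⟨hsub, fun he => hCe ?_⟩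
            rw [← hCc, he]⟩
          have := Finset.eq_of_subset_of_card_le hBC this
          rw [this, hCc]
        · exact Or.inr h1
      rcases hCB with h1 | h1
      · have hxB : x ∈ B := h1 hx
        have hzB : z ∈ B := h1 hz
        simp only [hxB, hzB, if_true] at hxy hyz
        split_ifs at hxy hyz with h2
        · exact f3 C hC h1 x hx y h2 z hz hxy hyz
        · have := f2 z hzB; omega
      · have hn : ∀ w ∈ C, w ∉ B := fun w hw hb => by
          have : w ∈ C ∩ (B : Set α) := ⟨hw, hb⟩
          rw [h1] at this; exact this
        simp only [hn x hx, hn z hz, if_false] at hxy hyz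
        split_ifs at hxy hyz with h2
        · have := f2 y h2; omega
        · refine g3 C hC (fun w hw => ?_) x hx y (by simp [h2, hy]) z hz (by omega) (by omega)
          have := hCY hw
          have := hn w hw
          simp_all
  · push Not at h
    obtain ⟨e⟩ : Nonempty (Y ≃ Fin Y.card) := ⟨Y.equivFin⟩
    refine ⟨fun y => if hy : y ∈ Y then e ⟨y, hy⟩ else 0, ?_, ?_, ?_⟩
    · intro x hx y hy hxy
      have hx' : x ∈ Y := hx
      have hy' : y ∈ Y := hy
      simp only [hx', hy', dif_pos] at hxy
      have := e.injective (Fin.ext hxy)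
      simpa using this
    · intro y hy
      simp only [hy, dif_pos]
      exact (e _).2
    · intro C hC hCY x hx y hy z hz _ _
      have hfin : C.Finite := Y.finite_toSet.subset hCY
      have hCc : ((hfin.toFinset : Finset α) : Set α) = C := hfin.coe_toFinset
      have hsub : hfin.toFinset ⊆ Y := by
        rw [← Finset.coe_subset, hCc]; exact hCY
      have h2 := h hfin.toFinset (by rw [hCc]; exact hC) ⟨x, by simpa using hx⟩
      by_contra hyC
      apply h2
      refine Finset.ssubset_iff_subset_ne.2 ⟨hsub, fun he => hyC ?_⟩
      rw [← he] at hy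
      simpa using hy

lemma card_le_two_of {s : Finset ℕ} (h : ∀ a ∈ s, ∀ b ∈ s, ∀ c ∈ s, a < b → b < c → False) :
    s.card ≤ 2 := by
  rcases s.eq_empty_or_nonempty with rfl | hs
  · simp
  · have : s ⊆ {s.min' hs, s.max' hs} := by
      intro b hb
      have h1 := s.min'_le b hb
      have h2 := s.le_max' b hb
      have h3 := h _ (s.min'_mem hs) b hb _ (s.max'_mem hs)
      simp only [Finset.mem_insert, Finset.mem_singleton]
      by_contra hc
      exact h3 (by omega) (by omega)
    exact (Finset.card_le_card this).trans Finset.card_le_two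

open Classical in
lemma finish_aux {α : Type*} (N : ℕ) (X Y : Finset α) (E : Set (α × α)) (G P : Finset α)
    (hG : G ⊆ X) (hP : P ⊆ Y) (hh : ∀ a ∈ G, ∀ x ∈ P, ∀ y ∈ P, (a, x) ∈ E → (a, y) ∈ E)
    (hGc : X.card ≤ 2 * G.card) (hPc : Y.card ≤ 2 ^ (N + 4) * P.card) :
    ∃ X' ⊆ (X : Set α), ∃ Y' ⊆ (Y : Set α),
      (X'.ncard : ℝ) ≥ (1 / 2 ^ (N + 4)) * (X : Set α).ncard ∧
      (Y'.ncard : ℝ) ≥ (1 / 2 ^ (N + 4)) * (Y : Set α).ncard ∧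
      (X' ×ˢ Y' ⊆ E ∨ (X' ×ˢ Y') ∩ E = ∅) := by
  have key : ∀ H : Finset α, H ⊆ G → G.card ≤ 2 * H.card →
      ((H : Set α) ×ˢ (P : Set α) ⊆ E ∨ ((H : Set α) ×ˢ (P : Set α)) ∩ E = ∅) →
      ∃ X' ⊆ (X : Set α), ∃ Y' ⊆ (Y : Set α),
      (X'.ncard : ℝ) ≥ (1 / 2 ^ (N + 4)) * (X : Set α).ncard ∧
      (Y'.ncard : ℝ) ≥ (1 / 2 ^ (N + 4)) * (Y : Set α).ncard ∧
      (X' ×ˢ Y' ⊆ E ∨ (X' ×ˢ Y') ∩ E = ∅) := by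
    intro H hHG hHc hH
    refine ⟨H, by exact_mod_cast hHG.trans hG, P, by exact_mod_cast hP, ?_, ?_, hH⟩
    · simp only [Set.ncard_coe_finset]
      have h1 : X.card ≤ 2 ^ (N + 4) * H.card := by
        have : 1 ≤ 2 ^ N := Nat.one_le_two_pow
        rw [pow_add]
        nlinarith
      have h2 : (X.card : ℝ) ≤ 2 ^ (N + 4) * H.card := by exact_mod_cast h1
      rw [ge_iff_le, one_div, inv_mul_le_iff₀ (by positivity)]
      exact h2
    · simp only [Set.ncard_coe_finset]
      have h2 : (Y.card : ℝ) ≤ 2 ^ (N + 4) * P.card := by exact_mod_cast hPc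
      rw [ge_iff_le, one_div, inv_mul_le_iff₀ (by positivity)]
      exact h2
  have hsum := Finset.card_filter_add_card_filter_not (s := G) (fun a => ∃ x ∈ P, (a, x) ∈ E)
  by_cases hc : G.card ≤ 2 * (G.filter (fun a => ∃ x ∈ P, (a, x) ∈ E)).card
  · refine key _ (Finset.filter_subset _ _) hc (Or.inl ?_)
    rintro ⟨a, y⟩ ⟨ha, hy⟩
    simp only [Finset.coe_filter, Set.mem_ofPred_eq] at ha
    obtain ⟨haG, x, hx, hax⟩ := ha
    exact hh a haG x hx y hy hax
  · refine key (G.filter (fun a => ¬ ∃ x ∈ P, (a, x) ∈ E)) (Finset.filter_subset _ _)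
      (by omega) (Or.inr ?_)
    rw [Set.eq_empty_iff_forall_notMem]
    rintro ⟨a, y⟩ ⟨⟨ha, hy⟩, hE⟩
    simp only [Finset.coe_filter, Set.mem_ofPred_eq] at ha
    exact ha.2 ⟨y, hy, hE⟩

def ballList {α : Type*} (L : List (Set α × List (Set α))) : List (Set α) :=
  L.flatMap fun p => p.1 :: p.2

lemma ballList_length {α : Type*} (L : List (Set α × List (Set α))) :
    (ballList L).length = SCCount L := by
  simp [ballList, SCCount, List.length_flatMap, add_comm]

open Classical in
lemma card_bad_le {α : Type*} (cut : Set α → Finset ℕ) (l : List (Set α))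
    (h : ∀ B ∈ l, (cut B).card ≤ 2) (s : Finset ℕ) (hs : ∀ j ∈ s, ∃ B ∈ l, j ∈ cut B) :
    s.card ≤ 2 * l.length := by
  have h1 : s ⊆ l.toFinset.biUnion cut := by
    intro j hj
    obtain ⟨B, hB, hj⟩ := hs j hj
    simp only [Finset.mem_biUnion, List.mem_toFinset]
    exact ⟨B, hB, hj⟩
  have h2 := Finset.card_biUnion_le_card_mul l.toFinset cut 2 (fun B hB => h B (by simpa using hB))
  have h3 := l.toFinset_card_le
  have h4 := Finset.card_le_card h1
  omega

/-- **Theorem (strong Erdős–Hajnal for bounded VC-minimal complexity).**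
For `N > 0`, let `k_N = 1/2^(N+4)`. If a finite bipartite graph `(X, Y; E)` has
VC-minimal complexity `< N`, then there are `X' ⊆ X`, `Y' ⊆ Y` with
`|X'| ≥ k_N |X|`, `|Y'| ≥ k_N |Y|` and `X' × Y' ⊆ E` or `(X' × Y') ∩ E = ∅`. -/
theorem vcmin_strong_erdos_hajnal {α : Type*} (N : ℕ) (hN : 0 < N)
    (X Y : Set α) (hX : X.Finite) (hY : Y.Finite) (hXY : Disjoint X Y)
    (E : Set (α × α)) (hE : E ⊆ X ×ˢ Y) (hVC : VCMinCompLT X Y E N) :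
    ∃ X' ⊆ X, ∃ Y' ⊆ Y,
      (X'.ncard : ℝ) ≥ (1 / 2 ^ (N + 4)) * X.ncard ∧
      (Y'.ncard : ℝ) ≥ (1 / 2 ^ (N + 4)) * Y.ncard ∧
      (X' ×ˢ Y' ⊆ E ∨ (X' ×ˢ Y') ∩ E = ∅) := by
  classical
  lift X to Finset α using hX
  lift Y to Finset α using hY
  obtain ⟨Ψ, hΨY, hD, hL⟩ := hVC
  have hNpow : N < 2 ^ N := Nat.lt_two_pow_self
  have hpow : 2 ^ (N + 4) = 16 * 2 ^ N := by ring
  by_cases hq : Y.card < 4 * N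
  · rcases Y.eq_empty_or_nonempty with rfl | ⟨y, hy⟩
    · exact finish_aux N X ∅ E X ∅ subset_rfl subset_rfl (by simp) (by omega) (by simp)
    · refine finish_aux N X Y E X {y} subset_rfl (by simpa using hy) (by simp) (by omega) ?_
      simp only [Finset.card_singleton]
      omega
  push Not at hq
  obtain ⟨f, f1, f2, f3⟩ := exists_order Ψ hD _ Y rfl
  set q := Y.card / (4 * N) with hqdef
  have hqpos : 0 < q := Nat.div_pos hq (by omega)
  have hqle : q * (4 * N) ≤ Y.card := Nat.div_mul_le_self _ _
  have hqlt : Y.card < 4 * N * (q + 1) := Nat.lt_mul_div_succ _ (by omega)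
  let P : ℕ → Finset α := fun j => Y.filter (fun y => f y / q = j)
  have himg : Y.image f = Finset.range Y.card := by
    apply Finset.eq_of_subset_of_card_le
    · intro i hi
      obtain ⟨y, hy, rfl⟩ := Finset.mem_image.1 hi
      exact Finset.mem_range.2 (f2 y hy)
    · rw [Finset.card_range, Finset.card_image_of_injOn f1]
  have hPc : ∀ j < 4 * N, q ≤ (P j).card := by
    intro j hj
    have hsub : Finset.Ico (j * q) (j * q + q) ⊆ (P j).image f := by
      intro i hi
      rw [Finset.mem_Ico] at hi
      have : i ∈ Y.image f := by
        rw [himg, Finset.mem_range]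
        have : (j + 1) * q ≤ 4 * N * q := Nat.mul_le_mul_right _ hj
        nlinarith
      obtain ⟨y, hy, rfl⟩ := Finset.mem_image.1 this
      refine Finset.mem_image.2 ⟨y, ?_, rfl⟩
      simp only [P, Finset.mem_filter]
      refine ⟨hy, ?_⟩
      rw [Nat.div_eq_iff hqpos]
      omega
    have := (Finset.card_le_card hsub).trans Finset.card_image_le
    simpa using this
  let cut : Set α → Finset ℕ := fun C =>
    (Finset.range (4 * N)).filter (fun j => ∃ x ∈ P j, ∃ y ∈ P j, x ∈ C ∧ y ∉ C)
  have hlt : ∀ x y, f x / q < f y / q → f x ≤ f y := by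
    intro x y h
    by_contra hc
    exact absurd (Nat.div_le_div_right (c := q) (le_of_not_ge hc)) (by omega)
  have hcut : ∀ C ∈ Ψ, (cut C).card ≤ 2 := by
    intro C hC
    apply card_le_two_of
    intro i hi j hj k hk hij hjk
    simp only [cut, P, Finset.mem_filter] at hi hj hk
    obtain ⟨-, x, ⟨hx, hxi⟩, -, -, hxC, -⟩ := hi
    obtain ⟨-, -, -, y, ⟨hy, hyi⟩, -, hyC⟩ := hj
    obtain ⟨-, z, ⟨hz, hzi⟩, -, -, hzC, -⟩ := hk
    exact hyC (f3 C hC (hΨY C hC) x hxC y hy z hzC (hlt _ _ (by omega)) (hlt _ _ (by omega)))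
  let good : α → ℕ → Prop := fun a j => ∀ x ∈ P j, ∀ y ∈ P j, (a, x) ∈ E → (a, y) ∈ E
  have hgood : ∀ a ∈ X, 2 * N ≤ ((Finset.range (4 * N)).filter (good a)).card := by
    intro a ha
    obtain ⟨L, ⟨hL1, -, hL3⟩, hL4⟩ := hL a ha
    have hbad := card_bad_le cut (ballList L) (by
      intro B hB
      apply hcut
      simp only [ballList, List.mem_flatMap, List.mem_cons] at hB
      obtain ⟨p, hp, rfl | h⟩ := hB
      · exact (hL1 p hp).1
      · exact (hL1 p hp).2 _ h) ((Finset.range (4 * N)).filter (fun j => ¬ good a j)) (by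
      intro j hj
      rw [Finset.mem_filter] at hj
      obtain ⟨hj, hb⟩ := hj
      by_contra hcon
      push Not at hcon
      apply hb
      have hsame : ∀ B ∈ ballList L, ∀ x ∈ P j, ∀ y ∈ P j, x ∈ B → y ∈ B := by
        intro B hB x hx y hy hxB
        by_contra hyB
        exact hcon B hB (Finset.mem_filter.2 ⟨hj, x, hx, y, hy, hxB, hyB⟩)
      intro x hx y hy hxE
      have hxS : x ∈ {b ∈ (Y : Set α) | (a, b) ∈ E} := ⟨(Finset.mem_filter.1 hx).1, hxE⟩
      have hyS : y ∈ {b ∈ (Y : Set α) | (a, b) ∈ E} := by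
        rw [hL3] at hxS ⊢
        simp only [Set.mem_iUnion, SwissCheese, Set.mem_sdiff, not_exists] at hxS ⊢
        obtain ⟨p, hp, h1, h2⟩ := hxS
        refine ⟨p, hp, hsame _ ?_ x hx y hy h1, fun K hK hyK => h2 K hK (hsame K ?_ y hy x hx hyK)⟩
        · simp only [ballList, List.mem_flatMap, List.mem_cons]
          exact ⟨p, hp, Or.inl rfl⟩
        · simp only [ballList, List.mem_flatMap, List.mem_cons]
          exact ⟨p, hp, Or.inr hK⟩
      exact hyS.2)
    rw [ballList_length] at hbad
    have hsum := Finset.card_filter_add_card_filter_not (s := Finset.range (4 * N)) (good a)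
    rw [Finset.card_range] at hsum
    omega
  obtain ⟨j, hj, hjX⟩ : ∃ j ∈ Finset.range (4 * N), X.card ≤ 2 * (X.filter (good · j)).card := by
    by_contra hcon
    push Not at hcon
    have hdc := Finset.sum_card_bipartiteAbove_eq_sum_card_bipartiteBelow
      (s := X) (t := Finset.range (4 * N)) good
    simp only [Finset.bipartiteAbove, Finset.bipartiteBelow] at hdc
    have h1 := Finset.card_nsmul_le_sum X _ _ hgood
    have h2 : ∑ j ∈ Finset.range (4 * N), 2 * (X.filter (good · j)).card
        < ∑ j ∈ Finset.range (4 * N), X.card :=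
      Finset.sum_lt_sum_of_nonempty ⟨0, by simp [hN]⟩ hcon
    rw [← Finset.mul_sum, ← hdc] at h2
    simp only [Finset.sum_const, Finset.card_range, smul_eq_mul] at h1 h2
    nlinarith
  refine finish_aux N X Y E (X.filter (good · j)) (P j) (Finset.filter_subset _ _)
    (Finset.filter_subset _ _) (fun a ha => (Finset.mem_filter.1 ha).2) hjX ?_
  have h1 := hPc j (Finset.mem_range.1 hj)
  have h2 : 2 ^ (N + 4) * q ≤ 2 ^ (N + 4) * (P j).card := Nat.mul_le_mul_left _ h1
  rw [hpow] at h2 ⊢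
  have h3 : N * q ≤ 2 ^ N * q := Nat.mul_le_mul_right _ hNpow.le
  have h4 : N ≤ N * q := Nat.le_mul_of_pos_right _ hqpos
  nlinarith
end

section
/- Let (X, Y; E) be a finite bipartite graph and Ψ a directed family of subsets of Y such that for each a ∈ X, E(a, Y) is a finite disjoint union of Ψ-Swiss cheeses. Let 𝓕 be the family consisting of Y together with all Ψ-balls occurring (as outer balls or holes) in these decompositions, let Z ∈ 𝓕, let 𝓕' be the set of balls in 𝓕 that are properly contained in Z, let C₁, ..., C_m be the ⊆-maximal elements of 𝓕', and let R = Z \ (C₁ ∪ ... ∪ C_m). Then for every a ∈ X, either E(a, R) = R or E(a, R) = ∅. -/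
open Set

/-- Claim 1 of the main theorem: with `Z` a member of the family consisting of `Y`
together with all balls occurring in the decompositions, `C₁, ..., C_m` the
maximal balls properly contained in `Z`, and `R = Z \ (C₁ ∪ ... ∪ C_m)`, for
every `a ∈ X` we have `E(a, R) = R` or `E(a, R) = ∅`. -/
theorem vcmin_claim_R {α : Type*} (X Y : Set α) (hX : X.Finite) (hY : Y.Finite)
    (hXY : Disjoint X Y) (E : Set (α × α)) (hE : E ⊆ X ×ˢ Y)
    (Ψ : Set (Set α)) (hΨY : ∀ B ∈ Ψ, B ⊆ Y) (hdir : DirectedFamily Ψ)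
    (L : α → List (Set α × List (Set α)))
    (hL : ∀ a ∈ X, IsSCDecomp Ψ {b ∈ Y | (a, b) ∈ E} (L a))
    (Balls : Set (Set α)) (hBalls : Balls = ⋃ a ∈ X, BallsOf (L a))
    (F : Set (Set α)) (hF : F = insert Y Balls)
    (Z : Set α) (hZ : Z ∈ F)
    (F' : Set (Set α)) (hF' : F' = {B ∈ Balls | B ⊂ Z})
    (M : Set (Set α)) (hM : M = {C ∈ F' | ∀ B ∈ F', C ⊆ B → B = C})
    (R : Set α) (hR : R = Z \ ⋃₀ M) :
    ∀ a ∈ X, {b ∈ R | (a, b) ∈ E} = R ∨ {b ∈ R | (a, b) ∈ E} = ∅ := by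
  have hBΨ : ∀ B ∈ Balls, B ∈ Ψ := by
    intro B hB
    rw [hBalls] at hB
    simp only [mem_iUnion] at hB
    obtain ⟨a, ha, p, hp, h⟩ := hB
    have h1 := (hL a ha).1 p hp
    rcases h with rfl | h
    · exact h1.1
    · exact h1.2 B h
  have hZY : Z ⊆ Y := by
    rw [hF] at hZ
    rcases hZ with rfl | h
    · exact subset_rfl
    · exact hΨY _ (hBΨ _ h)
  have hfin : F'.Finite := by
    apply hY.finite_subsets.subset
    intro B hB
    rw [hF'] at hB
    exact hB.2.subset.trans hZY
  have hnot : ∀ B ∈ F', ∀ b ∈ R, b ∉ B := by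
    intro B hB b hb hbB
    obtain ⟨C, hBC, hC⟩ := hfin.exists_le_maximal hB
    rw [hR] at hb
    apply hb.2
    refine ⟨C, ?_, hBC hbB⟩
    rw [hM]
    exact ⟨hC.prop, fun D hD hCD => (hC.eq_of_le hD hCD).symm⟩
  have hRZ : ∀ b ∈ R, b ∈ Z := by
    intro b hb
    rw [hR] at hb
    exact hb.1
  have key : ∀ B ∈ Balls, ∀ b ∈ R, ∀ c ∈ R, b ∈ B → c ∈ B := by
    intro B hB b hb c hc hbB
    have hcmp : B ⊆ Z ∨ Z ⊆ B ∨ B ∩ Z = ∅ := by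
      rw [hF] at hZ
      rcases hZ with rfl | h
      · exact Or.inl (hΨY _ (hBΨ _ hB))
      · exact hdir _ (hBΨ _ hB) _ (hBΨ _ h)
    by_cases hZB : Z ⊆ B
    · exact hZB (hRZ c hc)
    rcases hcmp with h | h | h
    · exact absurd hbB (hnot B (by rw [hF']; exact ⟨hB, h, hZB⟩) b hb)
    · exact absurd h hZB
    · have : b ∈ B ∩ Z := ⟨hbB, hRZ b hb⟩
      rw [h] at this
      exact this.elim
  intro a ha
  have hmem : ∀ b ∈ R, ((a, b) ∈ E ↔ ∃ p ∈ L a, b ∈ SwissCheese p.1 p.2) := by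
    intro b hb
    have h := Set.ext_iff.1 (hL a ha).2.2 b
    simp only [mem_setOf_eq, mem_iUnion, exists_prop] at h
    rw [← h]
    exact ⟨fun h => ⟨hZY (hRZ b hb), h⟩, fun h => h.2⟩
  have hin : ∀ p ∈ L a, ∀ B, (B = p.1 ∨ B ∈ p.2) → B ∈ Balls := by
    intro p hp B h
    rw [hBalls]
    simp only [mem_iUnion]
    exact ⟨a, ha, p, hp, h⟩
  rcases Set.eq_empty_or_nonempty {b ∈ R | (a, b) ∈ E} with h | ⟨b, hb, hbE⟩
  · exact Or.inr h
  · left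
    apply Set.Subset.antisymm (fun x hx => hx.1)
    intro c hc
    refine ⟨hc, ?_⟩
    obtain ⟨p, hp, h1, h2⟩ := (hmem b hb).1 hbE
    refine (hmem c hc).2 ⟨p, hp, key _ (hin p hp _ (Or.inl rfl)) b hb c hc h1, ?_⟩
    intro h3
    apply h2
    simp only [mem_iUnion, exists_prop] at h3 ⊢
    obtain ⟨K, hK, hcK⟩ := h3
    exact ⟨K, hK, key K (hin p hp K (Or.inr hK)) c hc b hb hcK⟩
end

section
/- Let (X, Y; E) be a finite bipartite graph and Ψ a directed family of subsets of Y such that for each a ∈ X, E(a, Y) is a finite disjoint union of Ψ-Swiss cheeses. Let 𝓕 be the family consisting of Y together with all Ψ-balls occurring (as outer balls or holes) in these decompositions, let Z ∈ 𝓕, let 𝓕' be the set of balls in 𝓕 that are properly contained in Z, let C₁, ..., C_m be the ⊆-maximal elements of 𝓕', and let C be the union of some subcollection of {C₁, ..., C_m}. If a ∈ X is such that no ball occurring in the decomposition of E(a, Y) is contained in C, then E(a, C) = ∅ or E(a, C) = C. -/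
open Set

/-- Claim 2 of the main theorem: with `C` a union of some subcollection of the
maximal balls properly contained in `Z`, if no ball in the decomposition of
`E(a, Y)` is contained in `C`, then `E(a, C) = ∅` or `E(a, C) = C`. -/
theorem vcmin_claim_C {α : Type*} (X Y : Set α) (hX : X.Finite) (hY : Y.Finite)
    (hXY : Disjoint X Y) (E : Set (α × α)) (hE : E ⊆ X ×ˢ Y)
    (Ψ : Set (Set α)) (hΨY : ∀ B ∈ Ψ, B ⊆ Y) (hdir : DirectedFamily Ψ)
    (L : α → List (Set α × List (Set α)))
    (hL : ∀ a ∈ X, IsSCDecomp Ψ {b ∈ Y | (a, b) ∈ E} (L a))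
    (Balls : Set (Set α)) (hBalls : Balls = ⋃ a ∈ X, BallsOf (L a))
    (F : Set (Set α)) (hF : F = insert Y Balls)
    (Z : Set α) (hZ : Z ∈ F)
    (F' : Set (Set α)) (hF' : F' = {B ∈ Balls | B ⊂ Z})
    (M : Set (Set α)) (hM : M = {C ∈ F' | ∀ B ∈ F', C ⊆ B → B = C})
    (T : Set (Set α)) (hT : T ⊆ M) (C : Set α) (hC : C = ⋃₀ T)
    (a : α) (ha : a ∈ X) (hno : ∀ B ∈ BallsOf (L a), ¬ B ⊆ C) :
    {b ∈ C | (a, b) ∈ E} = ∅ ∨ {b ∈ C | (a, b) ∈ E} = C := by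
  have hsubΨ : ∀ B ∈ Balls, B ∈ Ψ := by
    intro B hB
    rw [hBalls] at hB
    simp only [mem_iUnion] at hB
    obtain ⟨a', ha', p, hp, h⟩ := hB
    have h1 := (hL a' ha').1 p hp
    rcases h with h | h
    · rw [h]; exact h1.1
    · exact h1.2 B h
  have hCZ : C ⊆ Z := by
    rw [hC]
    apply sUnion_subset
    intro D hD
    have := hT hD
    rw [hM, hF'] at this
    exact this.1.2.1
  have key : ∀ B ∈ BallsOf (L a), ∀ x ∈ C, x ∈ B → C ⊆ B := by
    intro B hB x hxC hxB
    have hBB : B ∈ Balls := by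
      rw [hBalls]; simp only [mem_iUnion]; exact ⟨a, ha, hB⟩
    have hZB : Z ⊆ B ∨ B ⊆ Z := by
      rw [hF] at hZ
      rcases hZ with h | h
      · right; rw [h]; exact hΨY B (hsubΨ B hBB)
      · rcases hdir Z (hsubΨ Z h) B (hsubΨ B hBB) with h' | h' | h'
        · exact Or.inl h'
        · exact Or.inr h'
        · have : x ∈ Z ∩ B := ⟨hCZ hxC, hxB⟩
          rw [h'] at this
          exact this.elim
    by_cases hZs : Z ⊆ B
    · exact hCZ.trans hZs
    exfalso
    have hBZ : B ⊂ Z := ⟨hZB.resolve_left hZs, hZs⟩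
    have hBF : B ∈ F' := by rw [hF']; exact ⟨hBB, hBZ⟩
    have hx := hxC
    rw [hC] at hx
    obtain ⟨D, hDT, hxD⟩ := hx
    have hDC : D ⊆ C := by rw [hC]; exact subset_sUnion_of_mem hDT
    have hDM := hT hDT
    rw [hM] at hDM
    have hDB : D ∈ Balls := by
      have := hDM.1
      rw [hF'] at this
      exact this.1
    rcases hdir D (hsubΨ D hDB) B (hsubΨ B hBB) with h | h | h
    · have := hDM.2 B hBF h
      exact hno B hB (this ▸ hDC)
    · exact hno B hB (h.trans hDC)
    · have : x ∈ D ∩ B := ⟨hxD, hxB⟩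
      rw [h] at this
      exact this.elim
  by_cases hne : {b ∈ C | (a, b) ∈ E} = ∅
  · exact Or.inl hne
  right
  obtain ⟨x, hxC, hxE⟩ := nonempty_iff_ne_empty.mpr hne
  have hS := (hL a ha).2.2
  have hx : x ∈ {b ∈ Y | (a, b) ∈ E} := ⟨(hE hxE).2, hxE⟩
  rw [hS] at hx
  simp only [mem_iUnion] at hx
  obtain ⟨p, hp, hx1, hx2⟩ := hx
  apply Subset.antisymm (fun b hb => hb.1)
  intro y hy
  refine ⟨hy, ?_⟩
  have : y ∈ {b ∈ Y | (a, b) ∈ E} := by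
    rw [hS]
    simp only [mem_iUnion]
    refine ⟨p, hp, key p.1 ⟨p, hp, Or.inl rfl⟩ x hxC hx1 hy, ?_⟩
    intro hyK
    apply hx2
    simp only [mem_iUnion] at hyK ⊢
    obtain ⟨K, hK, hyK⟩ := hyK
    exact ⟨K, hK, key K ⟨p, hp, Or.inr hK⟩ y hy hyK hxC⟩
  exact this.2
end

section
/- Let (X, Y; E) be a finite bipartite graph and Ψ a directed family of subsets of Y such that for each a ∈ X, E(a, Y) is a finite disjoint union of Ψ-Swiss cheeses whose total number of outer balls plus total number of holes is < N + 1. Let C ⊆ Y, and let A₁ = {a ∈ X : some ball occurring in the decomposition of E(a, Y) is contained in C}. Then the bipartite graph (A₁, Y \ C; E ∩ (A₁ × (Y \ C))) has VC-minimal complexity < N, witnessed by the directed family Ψ' := {D ∩ (Y \ C) : D ∈ Ψ}. -/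
open Set

theorem sc_restrict {α : Type*} (Z B : Set α) (hs : List (Set α)) :
    SwissCheese (B ∩ Z) (hs.map (· ∩ Z)) = SwissCheese B hs ∩ Z := by
  ext x
  simp only [SwissCheese, mem_diff, mem_inter_iff, mem_iUnion, List.mem_map, exists_prop]
  constructor
  · rintro ⟨⟨h1, h2⟩, h3⟩
    exact ⟨⟨h1, fun ⟨K, hK, hx⟩ => h3 ⟨K ∩ Z, ⟨K, hK, rfl⟩, hx, h2⟩⟩, h2⟩
  · rintro ⟨⟨h1, h3⟩, h2⟩
    refine ⟨⟨h1, h2⟩, ?_⟩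
    rintro ⟨_, ⟨K, hK, rfl⟩, hx⟩
    exact h3 ⟨K, hK, hx.1⟩

theorem decomp_restrict {α : Type*} (Ψ : Set (Set α)) (Z S : Set α)
    (L : List (Set α × List (Set α))) (h : IsSCDecomp Ψ S L) :
    IsSCDecomp {D' | ∃ D ∈ Ψ, D' = D ∩ Z} (S ∩ Z)
      (L.map fun p => (p.1 ∩ Z, p.2.map (· ∩ Z))) := by
  obtain ⟨h1, h2, h3⟩ := h
  refine ⟨?_, ?_, ?_⟩
  · intro p hp
    obtain ⟨q, hq, rfl⟩ := List.mem_map.1 hp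
    refine ⟨⟨_, (h1 q hq).1, rfl⟩, ?_⟩
    intro K hK
    obtain ⟨K', hK', rfl⟩ := List.mem_map.1 hK
    exact ⟨_, (h1 q hq).2 _ hK', rfl⟩
  · rw [List.pairwise_map]
    refine h2.imp ?_
    intro p q hpq
    simp only [sc_restrict]
    rw [← Set.inter_inter_distrib_right, hpq, Set.empty_inter]
  · subst h3
    ext x
    simp only [mem_inter_iff, mem_iUnion, List.mem_map, exists_prop]
    constructor
    · rintro ⟨⟨p, hp, hx⟩, hz⟩
      exact ⟨_, ⟨p, hp, rfl⟩, by simp only [sc_restrict]; exact ⟨hx, hz⟩⟩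
    · rintro ⟨_, ⟨p, hp, rfl⟩, hx⟩
      simp only [sc_restrict] at hx
      exact ⟨⟨p, hp, hx.1⟩, hx.2⟩

theorem decomp_drop_outer {α : Type*} (Ψ : Set (Set α)) (S : Set α)
    (s t : List (Set α × List (Set α))) (p : Set α × List (Set α)) (hp : p.1 = ∅)
    (h : IsSCDecomp Ψ S (s ++ p :: t)) : IsSCDecomp Ψ S (s ++ t) := by
  obtain ⟨h1, h2, h3⟩ := h
  refine ⟨fun q hq => h1 q (by grind), h2.sublist (by simp), ?_⟩
  have : SwissCheese p.1 p.2 = ∅ := by simp [SwissCheese, hp]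
  rw [h3]
  ext x
  simp only [mem_iUnion, List.mem_append, List.mem_cons, exists_prop]
  constructor
  · rintro ⟨q, hq, hx⟩
    rcases hq with hq | rfl | hq
    · exact ⟨q, Or.inl hq, hx⟩
    · rw [this] at hx; exact hx.elim
    · exact ⟨q, Or.inr hq, hx⟩
  · rintro ⟨q, hq, hx⟩
    exact ⟨q, by tauto, hx⟩

theorem decomp_drop_hole {α : Type*} (Ψ : Set (Set α)) (S B : Set α)
    (s t : List (Set α × List (Set α))) (u v : List (Set α))
    (h : IsSCDecomp Ψ S (s ++ (B, u ++ ∅ :: v) :: t)) :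
    IsSCDecomp Ψ S (s ++ (B, u ++ v) :: t) := by
  have e : SwissCheese B (u ++ ∅ :: v) = SwissCheese B (u ++ v) := by
    ext x
    simp [SwissCheese, or_imp, forall_and]
  obtain ⟨h1, h2, h3⟩ := h
  refine ⟨?_, ?_, ?_⟩
  · intro q hq
    rcases List.mem_append.1 hq with hq | hq
    · exact h1 q (by simp [hq])
    rcases List.mem_cons.1 hq with rfl | hq
    · have := h1 (B, u ++ ∅ :: v) (by simp)
      exact ⟨this.1, fun K hK => this.2 K (by simp at hK ⊢; tauto)⟩
    · exact h1 q (by simp [hq])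
  · simp only [List.pairwise_append, List.pairwise_cons, List.mem_cons, forall_eq_or_imp, e] at h2 ⊢
    exact h2
  · rw [h3]
    ext x
    simp only [mem_iUnion, List.mem_append, List.mem_cons, exists_prop, or_and_right, exists_or,
      exists_eq_left, e]

/-- If each `E(a, Y)` decomposes into `Ψ`-Swiss cheeses with count `< N + 1`, and
`A₁` is the set of `a ∈ X` for which some ball of the decomposition is contained
in `C`, then `(A₁, Y \ C; E ∩ (A₁ × (Y \ C)))` has VC-minimal complexity `< N`,
witnessed by the directed family `Ψ' = {D ∩ (Y \ C) : D ∈ Ψ}`. -/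
theorem vcmin_A1_step {α : Type*} (X Y : Set α) (hX : X.Finite) (hY : Y.Finite)
    (hXY : Disjoint X Y) (E : Set (α × α)) (hE : E ⊆ X ×ˢ Y) (N : ℕ)
    (Ψ : Set (Set α)) (hΨY : ∀ B ∈ Ψ, B ⊆ Y) (hdir : DirectedFamily Ψ)
    (L : α → List (Set α × List (Set α)))
    (hL : ∀ a ∈ X, IsSCDecomp Ψ {b ∈ Y | (a, b) ∈ E} (L a) ∧ SCCount (L a) < N + 1)
    (C : Set α) (hC : C ⊆ Y)
    (A₁ : Set α) (hA₁ : A₁ = {a ∈ X | ∃ B ∈ BallsOf (L a), B ⊆ C})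
    (Ψ' : Set (Set α)) (hΨ' : Ψ' = {D' | ∃ D ∈ Ψ, D' = D ∩ (Y \ C)}) :
    (∀ D ∈ Ψ', D ⊆ Y \ C) ∧ DirectedFamily Ψ' ∧
    ∀ a ∈ A₁, ∃ L', IsSCDecomp Ψ' {b ∈ Y \ C | (a, b) ∈ E} L' ∧ SCCount L' < N := by
  subst hA₁ hΨ'
  refine ⟨?_, ?_, ?_⟩
  · rintro _ ⟨D, hD, rfl⟩
    exact inter_subset_right
  · rintro _ ⟨D, hD, rfl⟩ _ ⟨F, hF, rfl⟩
    rcases hdir D hD F hF with h | h | h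
    · exact Or.inl (inter_subset_inter_left _ h)
    · exact Or.inr (Or.inl (inter_subset_inter_left _ h))
    · refine Or.inr (Or.inr ?_)
      rw [← Set.inter_inter_distrib_right, h, Set.empty_inter]
  · rintro a ⟨haX, B, ⟨p, hp, hB⟩, hBC⟩
    obtain ⟨hd, hc⟩ := hL a haX
    have hd' := decomp_restrict Ψ (Y \ C) _ _ hd
    have hS : {b ∈ Y | (a, b) ∈ E} ∩ (Y \ C) = {b ∈ Y \ C | (a, b) ∈ E} := by
      ext x
      simp only [mem_inter_iff, mem_setOf_eq, mem_diff]
      tauto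
    rw [hS] at hd'
    have hBe : B ∩ (Y \ C) = ∅ := by
      ext x
      simp only [mem_inter_iff, mem_diff, mem_empty_iff_false, iff_false]
      exact fun h => h.2.2 (hBC h.1)
    obtain ⟨s, t, hst⟩ := List.append_of_mem hp
    rw [hst] at hd' hc
    rw [List.map_append, List.map_cons] at hd'
    rcases hB with rfl | hB
    · refine ⟨_, decomp_drop_outer _ _ _ _ _ hBe hd', ?_⟩
      simp [SCCount, Function.comp_def] at hc ⊢
      omega
    · obtain ⟨u, v, huv⟩ := List.append_of_mem hB
      rw [huv, List.map_append, List.map_cons, hBe] at hd'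
      refine ⟨_, decomp_drop_hole _ _ _ _ _ _ _ hd', ?_⟩
      simp [SCCount, Function.comp_def, huv] at hc ⊢
      omega
end

section
/- Let H be a finite simple graph that is a forest (i.e., acyclic), and let X and Y be disjoint subsets of the vertex set of H. Let E ⊆ X × Y be the relation E = {(x, y) ∈ X × Y : x is adjacent to y in H}. Then the finite bipartite graph (X, Y; E) has VC-minimal complexity < 3; in fact there is a directed family Ψ of subsets of Y such that for each a ∈ X, E(a, Y) is a disjoint union of at most 2 Ψ-balls (Ψ-Swiss cheeses with no holes). -/
open Set

lemma forest_parent {V : Type*} (H : SimpleGraph V) (hH : H.IsAcyclic) :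
    ∃ p : V → V, ∀ a b, H.Adj a b → p a = b ∨ p b = a := by
  classical
  have hr : ∀ v, H.Reachable v (H.connectedComponentMk v).out := by
    intro v
    exact (SimpleGraph.ConnectedComponent.exact (Quot.out_eq (H.connectedComponentMk v))).symm
  have hq : ∀ v, ∃ w : H.Walk v (H.connectedComponentMk v).out, w.IsPath := fun v =>
    (hr v).exists_isPath
  choose q hqp using hq
  have key : ∀ a b r (hab : H.Adj a b) (w : H.Walk a r) (z : H.Walk b r), w.IsPath → z.IsPath →
      w.snd = b ∨ z.snd = a := by
    intro a b r hab w z hw hz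
    by_cases ha : a ∈ z.support
    · right
      have h1 : (z.takeUntil a ha).IsPath := hz.takeUntil ha
      have h2 : (SimpleGraph.Walk.cons hab.symm SimpleGraph.Walk.nil).IsPath := by
        simp [hab.ne']
      have h3 := congrArg Subtype.val (hH.path_unique ⟨_, h1⟩ ⟨_, h2⟩)
      simp only at h3
      rw [← z.take_spec ha, h3]
      simp
    · left
      have h2 : (SimpleGraph.Walk.cons hab z).IsPath := by
        simp [hz, ha]
      have h3 := congrArg Subtype.val (hH.path_unique ⟨_, hw⟩ ⟨_, h2⟩)
      simp only at h3
      rw [h3]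
      simp
  refine ⟨fun v => (q v).snd, fun a b hab => ?_⟩
  have hc : H.connectedComponentMk b = H.connectedComponentMk a :=
    SimpleGraph.ConnectedComponent.sound hab.symm.reachable
  have := hqp b
  have hz : ∀ r (w : H.Walk b r), w.IsPath → ∀ r' (h : r = r'), 
      ∃ z : H.Walk b r', z.IsPath ∧ z.snd = w.snd := by
    rintro r w hw r' rfl
    exact ⟨w, hw, rfl⟩
  obtain ⟨z, hz1, hz2⟩ := hz _ (q b) (hqp b) _ (congrArg Quot.out hc)
  have := key a b _ hab (q a) z (hqp a) hz1
  simpa [hz2] using this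

lemma forest_aux {V : Type*}
    (H : SimpleGraph V) (hH : H.IsAcyclic) (X Y : Set V)
    (E : Set (V × V)) (hE : E = {q ∈ X ×ˢ Y | H.Adj q.1 q.2}) :
    ∃ Ψ : Set (Set V), (∀ B ∈ Ψ, B ⊆ Y) ∧ DirectedFamily Ψ ∧
      ∀ a ∈ X, ∃ C D, IsSCDecomp Ψ {b ∈ Y | (a, b) ∈ E} [(C, []), (D, [])] := by
  obtain ⟨p, hp⟩ := forest_parent H hH
  refine ⟨{B | B ⊆ Y ∧ (B.Subsingleton ∨ ∃ a, B = {b ∈ Y | H.Adj a b ∧ p b = a})},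
    fun B hB => hB.1, ?_, ?_⟩
  · have hs : ∀ B₁ B₂ : Set V, B₁.Subsingleton → B₁ ⊆ B₂ ∨ B₁ ∩ B₂ = ∅ := by
      intro B₁ B₂ h
      by_cases hn : (B₁ ∩ B₂).Nonempty
      · obtain ⟨x, hx1, hx2⟩ := hn
        left
        intro y hy
        rwa [h hy hx1]
      · right
        exact Set.not_nonempty_iff_eq_empty.1 hn
    rintro B₁ ⟨-, h1⟩ B₂ ⟨-, h2⟩
    rcases h1 with h1 | ⟨a, rfl⟩
    · have := hs B₁ B₂ h1
      tauto
    rcases h2 with h2 | ⟨b, rfl⟩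
    · have := hs B₂ {b ∈ Y | H.Adj a b ∧ p b = a} h2
      rw [Set.inter_comm B₂] at this
      tauto
    by_cases hab : a = b
    · subst hab
      exact Or.inl subset_rfl
    · right; right
      ext x
      simp only [Set.mem_inter_iff, Set.mem_setOf_eq, Set.mem_empty_iff_false, iff_false]
      rintro ⟨⟨-, -, h⟩, -, -, h'⟩
      exact hab (h.symm.trans h')
  · intro a ha
    refine ⟨{b ∈ Y | H.Adj a b ∧ p b = a}, {b ∈ Y | H.Adj a b ∧ p b ≠ a}, ?_, ?_, ?_⟩
    · intro q hq
      simp only [List.mem_cons, List.not_mem_nil, or_false] at hq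
      rcases hq with rfl | rfl
      · exact ⟨⟨fun x hx => hx.1, Or.inr ⟨a, rfl⟩⟩, by simp⟩
      · refine ⟨⟨fun x hx => hx.1, Or.inl ?_⟩, by simp⟩
        rintro x ⟨-, hx, hx'⟩ y ⟨-, hy, hy'⟩
        have h1 := (hp a x hx).resolve_right hx'
        have h2 := (hp a y hy).resolve_right hy'
        exact h1.symm.trans h2
    · simp only [List.pairwise_cons, SwissCheese]
      simp
      ext x
      simp
      tauto
    · subst hE
      ext x
      simp [SwissCheese]
      tauto

/-- A forest `H`, together with disjoint vertex sets `X, Y` and the adjacency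
relation `E ⊆ X × Y`, gives a bipartite graph of VC-minimal complexity `< 3`;
in fact there is a directed family `Ψ` of subsets of `Y` such that each `E(a, Y)`
is a disjoint union of at most 2 `Ψ`-balls (Swiss cheeses with no holes). -/
theorem forest_vcmin_complexity_lt_three {V : Type*} [Fintype V]
    (H : SimpleGraph V) (hH : H.IsAcyclic) (X Y : Set V) (hXY : Disjoint X Y)
    (E : Set (V × V)) (hE : E = {q ∈ X ×ˢ Y | H.Adj q.1 q.2}) :
    VCMinCompLT X Y E 3 ∧
    ∃ Ψ : Set (Set V), (∀ B ∈ Ψ, B ⊆ Y) ∧ DirectedFamily Ψ ∧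
      ∀ a ∈ X, ∃ L, IsSCDecomp Ψ {b ∈ Y | (a, b) ∈ E} L ∧
        L.length ≤ 2 ∧ ∀ q ∈ L, q.2 = ([] : List (Set V)) := by
  obtain ⟨Ψ, h1, h2, h3⟩ := forest_aux H hH X Y E hE
  refine ⟨⟨Ψ, h1, h2, fun a ha => ?_⟩, Ψ, h1, h2, fun a ha => ?_⟩
  · obtain ⟨C, D, h⟩ := h3 a ha
    exact ⟨_, h, by simp [SCCount]⟩
  · obtain ⟨C, D, h⟩ := h3 a ha
    exact ⟨_, h, by simp, by simp⟩
end

section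
/- Let H be a finite simple graph that is a forest (i.e., acyclic), and let X and Y be disjoint subsets of the vertex set of H. Then there exist X' ⊆ X and Y' ⊆ Y with |X'| ≥ (1/2^7)·|X| and |Y'| ≥ (1/2^7)·|Y| such that either every vertex of X' is adjacent in H to every vertex of Y', or no vertex of X' is adjacent in H to any vertex of Y'. -/
open Set

theorem forest_orient {V : Type*} (H : SimpleGraph V) (hH : H.IsAcyclic) :
    ∃ f : V → V, ∀ x y, H.Adj x y → f x = y ∨ f y = x := by
  classical
  have hr : ∀ x, ∃ p : H.Walk x (H.connectedComponentMk x).out, p.IsPath := by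
    intro x
    have h : H.Reachable x (H.connectedComponentMk x).out := by
      apply SimpleGraph.ConnectedComponent.exact
      exact (Quot.out_eq _).symm
    exact h.exists_isPath
  choose P hP using hr
  refine ⟨fun x => (P x).snd, fun x y hxy => ?_⟩
  by_cases h : y ∈ (P x).support
  · exact Or.inl (hH.eq_snd_of_adj_start (hP x) hxy h).symm
  · right
    have hc : H.connectedComponentMk x = H.connectedComponentMk y :=
      SimpleGraph.ConnectedComponent.sound hxy.reachable
    have key : ∀ c, c = H.connectedComponentMk y → ∀ q : H.Walk x c.out, q.IsPath →
        y ∉ q.support → (P y).snd = x := by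
      rintro c rfl q hq hy
      have h1 := congrArg Subtype.val
        (hH.path_unique ⟨P y, hP y⟩ ⟨SimpleGraph.Walk.cons hxy.symm q, hq.cons hy⟩)
      simp only at h1
      rw [h1, SimpleGraph.Walk.snd_cons]
    exact key _ hc _ (hP x) h

theorem one_of_two {V : Type*} [Finite V] (X A B : Set V) (h : X ⊆ A ∪ B) :
    X.ncard ≤ 2 * A.ncard ∨ X.ncard ≤ 2 * B.ncard := by
  have h1 := Set.ncard_le_ncard h (Set.toFinite _)
  have h2 := Set.ncard_union_le A B
  omega

theorem half_split {V : Type*} [Finite V] (f : V → V) (X Y : Set V) :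
    ∃ X1 ⊆ X, ∃ Y1 ⊆ Y, X.ncard ≤ 2 * X1.ncard ∧ Y.ncard ≤ 2 * Y1.ncard + 1 ∧
      ∀ x ∈ X1, f x ∉ Y1 := by
  obtain ⟨A, hA, hAc⟩ := Set.exists_subset_card_eq (s := Y) (n := Y.ncard / 2) (by omega)
  have hB := Set.ncard_sdiff_add_ncard_of_subset hA (Set.toFinite _)
  rcases one_of_two X {x ∈ X | f x ∉ A} {x ∈ X | f x ∉ Y \ A}
    (by intro x hx; simp [hx]; tauto) with h | h
  · exact ⟨_, fun x hx => hx.1, A, hA, h, by omega, fun x hx => hx.2⟩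
  · exact ⟨_, fun x hx => hx.1, Y \ A, Set.diff_subset, h, by omega, fun x hx => hx.2⟩

theorem small_case {V : Type*} [Finite V]
    (H : SimpleGraph V) (X Y : Set V) (hX : X.ncard ≤ 2) :
    ∃ X' ⊆ X, ∃ Y' ⊆ Y, X.ncard ≤ 128 * X'.ncard ∧ Y.ncard ≤ 128 * Y'.ncard ∧
      ((∀ x ∈ X', ∀ y ∈ Y', H.Adj x y) ∨ (∀ x ∈ X', ∀ y ∈ Y', ¬ H.Adj x y)) := by
  rcases X.eq_empty_or_nonempty with rfl | ⟨a, ha⟩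
  · exact ⟨∅, subset_rfl, Y, subset_rfl, by simp, by omega, by simp⟩
  rcases one_of_two Y {y ∈ Y | H.Adj a y} {y ∈ Y | ¬ H.Adj a y}
    (by intro y hy; simp [hy]; tauto) with h | h
  · exact ⟨{a}, by simpa using ha, {y ∈ Y | H.Adj a y}, fun y hy => hy.1, by simp; omega, by omega,
      Or.inl (by rintro x rfl y hy; exact hy.2)⟩
  · exact ⟨{a}, by simpa using ha, {y ∈ Y | ¬ H.Adj a y}, fun y hy => hy.1, by simp; omega, by omega,
      Or.inr (by rintro x rfl y hy; exact hy.2)⟩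

theorem forest_nat {V : Type*} [Finite V]
    (H : SimpleGraph V) (hH : H.IsAcyclic) (X Y : Set V) :
    ∃ X' ⊆ X, ∃ Y' ⊆ Y, X.ncard ≤ 128 * X'.ncard ∧ Y.ncard ≤ 128 * Y'.ncard ∧
      ((∀ x ∈ X', ∀ y ∈ Y', H.Adj x y) ∨ (∀ x ∈ X', ∀ y ∈ Y', ¬ H.Adj x y)) := by
  by_cases hX : X.ncard ≤ 2
  · exact small_case H X Y hX
  by_cases hY : Y.ncard ≤ 2
  · obtain ⟨Y', hY', X', hX', h1, h2, h3⟩ := small_case H Y X hY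
    refine ⟨X', hX', Y', hY', h2, h1, ?_⟩
    rcases h3 with h3 | h3
    · exact Or.inl fun x hx y hy => (h3 y hy x hx).symm
    · exact Or.inr fun x hx y hy h => h3 y hy x hx h.symm
  obtain ⟨f, hf⟩ := forest_orient H hH
  obtain ⟨X1, hX1, Y1, hY1, a1, a2, a3⟩ := half_split f X Y
  obtain ⟨Y2, hY2, X2, hX2, b1, b2, b3⟩ := half_split f Y1 X1
  refine ⟨X2, hX2.trans hX1, Y2, hY2.trans hY1, by omega, by omega, Or.inr ?_⟩
  intro x hx y hy h
  rcases hf x y h with h | h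
  · exact a3 x (hX2 hx) (h ▸ hY2 hy)
  · exact b3 y hy (h ▸ hx)

/-- Strong Erdős–Hajnal for forests with constant `1/2^7`: for a finite forest `H`
and disjoint vertex sets `X, Y`, there are `X' ⊆ X`, `Y' ⊆ Y` of proportion at
least `1/2^7` such that `X'` is completely joined to, or completely disjoint
from, `Y'` in `H`. -/
theorem forest_strong_erdos_hajnal {V : Type*} [Fintype V]
    (H : SimpleGraph V) (hH : H.IsAcyclic) (X Y : Set V) (hXY : Disjoint X Y) :
    ∃ X' ⊆ X, ∃ Y' ⊆ Y,
      (X'.ncard : ℝ) ≥ (1 / 2 ^ 7) * X.ncard ∧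
      (Y'.ncard : ℝ) ≥ (1 / 2 ^ 7) * Y.ncard ∧
      ((∀ x ∈ X', ∀ y ∈ Y', H.Adj x y) ∨ (∀ x ∈ X', ∀ y ∈ Y', ¬ H.Adj x y)) := by
  obtain ⟨X', hX', Y', hY', h1, h2, h3⟩ := forest_nat H hH X Y
  have h1' : (X.ncard : ℝ) ≤ 128 * X'.ncard := by exact_mod_cast h1
  have h2' : (Y.ncard : ℝ) ≤ 128 * Y'.ncard := by exact_mod_cast h2
  exact ⟨X', hX', Y', hY', by linarith, by linarith, h3⟩
end
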